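/- Let E = (−1,1)^d, let π̂_0 be a Gaussian PSD model of order M_0 on ℝ^d, let Q̂(u,x) be a Gaussian PSD model of order M_Q on ℝ^d × ℝ^d, and let Ĝ(x,y) be a Gaussian PSD model of order M_G on ℝ^d × ℝ^{d'}. Given a sequence of observations z_1, z_2, … in ℝ^{d'}, define recursively π̂_n(x) = Ĝ(x, z_n) · (∫_E Q̂(u,x) π̂_{n−1}(u) du) / Z_n, where Z_n = ∫_E Ĝ(x, z_n) (∫_E Q̂(u,x) π̂_{n−1}(u) du) dx, and assume Z_k > 0 for all 1 ≤ k ≤ n. Then for every n ≥ 1, π̂_n is a Gaussian PSD model of order at most M_Q · M_G (independent of n and of M_0). -/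

import Mathlib

open MeasureTheory Matrix
open scoped BigOperators

noncomputable section

/-- The Gaussian kernel with precision vector `η`. -/
def gk {ι : Type*} [Fintype ι] (η : ι → ℝ) (x x' : ι → ℝ) : ℝ :=
  Real.exp (-∑ l, η l * (x l - x' l) ^ 2)

/-- `f` is a Gaussian PSD model of order (at most) `N` on `ℝ^ι`. -/
def IsGaussianPSD {ι : Type*} [Fintype ι] (N : ℕ) (f : (ι → ℝ) → ℝ) : Prop :=
  ∃ (A : Matrix (Fin N) (Fin N) ℝ) (pts : Fin N → ι → ℝ) (η : ι → ℝ),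
    A.PosSemidef ∧ (∀ l, 0 < η l) ∧
    ∀ x, f x = ∑ i, ∑ j, A i j * gk η x (pts i) * gk η x (pts j)

lemma posSemidef_real_iff_sum {κ : Type*} [Fintype κ] {A : Matrix κ κ ℝ} :
    A.PosSemidef ↔ (∀ i j, A i j = A j i) ∧
      ∀ v : κ → ℝ, 0 ≤ ∑ i, ∑ j, A i j * v i * v j := by
  have key : ∀ v : κ → ℝ, star v ⬝ᵥ (A *ᵥ v) = ∑ i, ∑ j, A i j * v i * v j := fun v => by
    simp only [dotProduct, mulVec, Finset.mul_sum, Pi.star_apply, star_trivial]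
    exact Finset.sum_congr rfl fun i _ => Finset.sum_congr rfl fun j _ => by ring
  rw [posSemidef_iff_dotProduct_mulVec]
  refine and_congr ⟨fun h i j => by simpa using h.apply j i,
    fun h => IsHermitian.ext fun i j => by simpa using h j i⟩ ?_
  exact forall_congr' fun v => by rw [key]

lemma Matrix.PosSemidef.diagonal_congr {κ : Type*} [Fintype κ] {A : Matrix κ κ ℝ}
    (hA : A.PosSemidef) (c : κ → ℝ) : (of fun i j => A i j * c i * c j).PosSemidef := by
  rw [posSemidef_real_iff_sum] at hA ⊢
  refine ⟨fun i j => by simp only [of_apply]; rw [hA.1 i j]; ring, fun v => ?_⟩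
  refine (hA.2 fun i => c i * v i).trans_eq ?_
  refine Finset.sum_congr rfl fun i _ => Finset.sum_congr rfl fun j _ => ?_
  simp only [of_apply]
  ring

/-- The Gram matrix of a finite family of functions with respect to a nonnegative weight. -/
lemma posSemidef_integral_gram {α κ : Type*} [MeasurableSpace α] [Fintype κ] {μ : Measure α}
    {f : α → ℝ} (hf : ∀ u, 0 ≤ f u) {g : κ → α → ℝ}
    (hint : ∀ i j, Integrable (fun u => g i u * g j u * f u) μ) :
    (of fun i j => ∫ u, g i u * g j u * f u ∂μ).PosSemidef := by
  refine posSemidef_real_iff_sum.2 ⟨fun i j => ?_, fun v => ?_⟩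
  · simp only [of_apply, mul_comm (g i _)]
  · have hint' : ∀ i j, Integrable (fun u => g i u * g j u * f u * v i * v j) μ :=
      fun i j => ((hint i j).mul_const _).mul_const _
    have key : ∑ i, ∑ j, (∫ u, g i u * g j u * f u ∂μ) * v i * v j =
        ∫ u, ∑ i, ∑ j, g i u * g j u * f u * v i * v j ∂μ := by
      rw [integral_finsetSum _ fun i _ => integrable_finsetSum _ fun j _ => hint' i j]
      refine Finset.sum_congr rfl fun i _ => ?_
      rw [integral_finsetSum _ fun j _ => hint' i j]
      exact Finset.sum_congr rfl fun j _ => by rw [integral_mul_const, integral_mul_const]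
    simp only [of_apply]
    rw [key]
    refine integral_nonneg fun u => ?_
    have : ∑ i, ∑ j, g i u * g j u * f u * v i * v j = f u * (∑ i, v i * g i u) ^ 2 := by
      rw [sq, Finset.sum_mul_sum, Finset.mul_sum]
      refine Finset.sum_congr rfl fun i _ => ?_
      rw [Finset.mul_sum]
      exact Finset.sum_congr rfl fun j _ => by ring
    simp only [this]
    exact mul_nonneg (hf u) (sq_nonneg _)

@[fun_prop]
lemma continuous_gk {ι : Type*} [Fintype ι] (η x' : ι → ℝ) : Continuous fun x => gk η x x' := by
  unfold gk
  fun_prop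

/-- The product of two Gaussian kernels is a scalar multiple of a Gaussian kernel centred at the
precision-weighted mean of the two centres. -/
lemma gk_mul_gk {ι : Type*} [Fintype ι] {η θ : ι → ℝ} (hη : ∀ l, 0 < η l) (hθ : ∀ l, 0 < θ l)
    (x a b : ι → ℝ) :
    gk η x a * gk θ x b = gk (fun l => η l * θ l / (η l + θ l)) a b *
      gk (η + θ) x (fun l => (η l * a l + θ l * b l) / (η l + θ l)) := by
  unfold gk
  rw [← Real.exp_add, ← Real.exp_add, ← neg_add, ← neg_add, ← Finset.sum_add_distrib,
    ← Finset.sum_add_distrib]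
  congr 2
  refine Finset.sum_congr rfl fun l _ => ?_
  have : η l + θ l ≠ 0 := (add_pos (hη l) (hθ l)).ne'
  simp only [Pi.add_apply]
  field_simp
  ring

namespace IsGaussianPSD

variable {ι : Type*} [Fintype ι]

lemma nonneg {N : ℕ} {f : (ι → ℝ) → ℝ} (hf : IsGaussianPSD N f) (x : ι → ℝ) : 0 ≤ f x := by
  obtain ⟨A, pts, η, hA, -, h⟩ := hf
  rw [h]
  exact (posSemidef_real_iff_sum.1 hA).2 _

lemma continuous {N : ℕ} {f : (ι → ℝ) → ℝ} (hf : IsGaussianPSD N f) : Continuous f := by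
  obtain ⟨A, pts, η, -, -, h⟩ := hf
  rw [funext h]
  fun_prop

lemma of_fintype {κ : Type*} [Fintype κ] {N : ℕ} (e : κ ≃ Fin N) {f : (ι → ℝ) → ℝ}
    {A : Matrix κ κ ℝ} (hA : A.PosSemidef) (pts : κ → ι → ℝ) {η : ι → ℝ} (hη : ∀ l, 0 < η l)
    (h : ∀ x, f x = ∑ i, ∑ j, A i j * gk η x (pts i) * gk η x (pts j)) : IsGaussianPSD N f := by
  refine ⟨A.submatrix e.symm e.symm, pts ∘ e.symm, η, hA.submatrix _, hη, fun x => ?_⟩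
  rw [h, ← e.symm.sum_comp]
  refine Finset.sum_congr rfl fun i _ => ?_
  rw [← e.symm.sum_comp]
  rfl

lemma const_mul {N : ℕ} {f : (ι → ℝ) → ℝ} (hf : IsGaussianPSD N f) {c : ℝ} (hc : 0 ≤ c) :
    IsGaussianPSD N fun x => c * f x := by
  obtain ⟨A, pts, η, hA, hη, h⟩ := hf
  refine ⟨c • A, pts, η, hA.smul hc, hη, fun x => ?_⟩
  simp only [h, Finset.mul_sum, Matrix.smul_apply, smul_eq_mul, mul_assoc]

lemma mul {M N : ℕ} {f g : (ι → ℝ) → ℝ} (hf : IsGaussianPSD M f) (hg : IsGaussianPSD N g) :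
    IsGaussianPSD (M * N) fun x => f x * g x := by
  obtain ⟨A, p, η, hA, hη, hf⟩ := hf
  obtain ⟨B, q, θ, hB, hθ, hg⟩ := hg
  refine of_fintype finProdFinEquiv
    ((hA.kronecker hB).diagonal_congr
      fun i => gk (fun l => η l * θ l / (η l + θ l)) (p i.1) (q i.2))
    (fun i l => (η l * p i.1 l + θ l * q i.2 l) / (η l + θ l)) (η := η + θ)
    (fun l => add_pos (hη l) (hθ l)) fun x => ?_
  simp only [hf, hg, Fintype.sum_prod_type, Finset.sum_mul_sum, of_apply, kroneckerMap_apply]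
  refine Finset.sum_congr rfl fun i _ => Finset.sum_congr rfl fun k _ =>
    Finset.sum_congr rfl fun j _ => Finset.sum_congr rfl fun l _ => ?_
  linear_combination (A i j * B k l) * (gk η x (p j) * gk θ x (q l)) *
      gk_mul_gk hη hθ x (p i) (q k) +
    (A i j * B k l) * (gk (fun l => η l * θ l / (η l + θ l)) (p i) (q k) *
      gk (η + θ) x (fun l' => (η l' * p i l' + θ l' * q k l') / (η l' + θ l'))) *
      gk_mul_gk hη hθ x (p j) (q l)

end IsGaussianPSD

/-- Fixing the second variable of a Gaussian PSD model on a product space gives a Gaussian PSD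
model of the same order. -/
lemma isGaussianPSD_section {ι ι' : Type*} [Fintype ι] [Fintype ι'] {N : ℕ}
    {A : Matrix (Fin N) (Fin N) ℝ} (hA : A.PosSemidef) (a : Fin N → ι → ℝ) (b : Fin N → ι' → ℝ)
    {η : ι → ℝ} (hη : ∀ l, 0 < η l) (θ : ι' → ℝ) (y : ι' → ℝ) :
    IsGaussianPSD N fun x => ∑ i, ∑ j, A i j *
      (gk η x (a i) * gk θ y (b i)) * (gk η x (a j) * gk θ y (b j)) := by
  refine ⟨_, a, η, hA.diagonal_congr fun i => gk θ y (b i), hη, fun x => ?_⟩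
  refine Finset.sum_congr rfl fun i _ => Finset.sum_congr rfl fun j _ => ?_
  simp only [of_apply]
  ring

/-- Integrating out the first variable of a Gaussian PSD model on a product space against a
nonnegative continuous weight gives a Gaussian PSD model of the same order. -/
lemma isGaussianPSD_setIntegral {ι ι' : Type*} [Fintype ι] [Fintype ι'] {N : ℕ}
    {A : Matrix (Fin N) (Fin N) ℝ} (hA : A.PosSemidef) (a : Fin N → ι → ℝ) (b : Fin N → ι' → ℝ)
    (η : ι → ℝ) {θ : ι' → ℝ} (hθ : ∀ l, 0 < θ l) {E K : Set (ι → ℝ)} (hK : IsCompact K)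
    (hEK : E ⊆ K) {f : (ι → ℝ) → ℝ} (hf : Continuous f) (hf0 : ∀ u, 0 ≤ f u) :
    IsGaussianPSD N fun x => ∫ u in E, (∑ i, ∑ j, A i j *
      (gk η u (a i) * gk θ x (b i)) * (gk η u (a j) * gk θ x (b j))) * f u := by
  have hint : ∀ i j, IntegrableOn (fun u => gk η u (a i) * gk η u (a j) * f u) E := fun i j =>
    (ContinuousOn.integrableOn_compact hK (by fun_prop)).mono_set hEK
  refine ⟨_, b, θ, hA.hadamard (posSemidef_integral_gram hf0 hint), hθ, fun x => ?_⟩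
  have hint' : ∀ i j, IntegrableOn (fun u => A i j * gk θ x (b i) * gk θ x (b j) *
      (gk η u (a i) * gk η u (a j) * f u)) E := fun i j => (hint i j).const_mul _
  calc
    _ = ∫ u in E, ∑ i, ∑ j, A i j * gk θ x (b i) * gk θ x (b j) *
        (gk η u (a i) * gk η u (a j) * f u) := by
      refine integral_congr_ae (.of_forall fun u => ?_)
      simp only [Finset.sum_mul]
      exact Finset.sum_congr rfl fun i _ => Finset.sum_congr rfl fun j _ => by ring
    _ = _ := by
      rw [integral_finsetSum _ fun i _ => integrable_finsetSum _ fun j _ => hint' i j]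
      refine Finset.sum_congr rfl fun i _ => ?_
      rw [integral_finsetSum _ fun j _ => hint' i j]
      refine Finset.sum_congr rfl fun j _ => ?_
      rw [integral_const_mul]
      simp only [hadamard_apply, of_apply]
      ring

/-- the filtering recursion with Gaussian PSD transition model `Q̂` of
order `M_Q` and observation model `Ĝ` of order `M_G`, started from a Gaussian PSD
model `π̂₀` of order `M₀`, produces at every step `n ≥ 1` a Gaussian PSD model of
order at most `M_Q * M_G`, independently of `n` and of `M₀`. -/
theorem psd_filter_constant_order
    (d d' M0 MQ MG : ℕ)
    -- the state domain E = (-1,1)^d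
    (E : Set (Fin d → ℝ)) (hE : E = Set.univ.pi fun _ : Fin d => Set.Ioo (-1 : ℝ) 1)
    -- π̂₀ is a Gaussian PSD model of order M₀
    (πhat : ℕ → (Fin d → ℝ) → ℝ) (hπ0 : IsGaussianPSD M0 (πhat 0))
    -- Q̂ is a Gaussian PSD model of order M_Q on ℝ^d × ℝ^d
    (Qhat : (Fin d → ℝ) → (Fin d → ℝ) → ℝ)
    (AQ : Matrix (Fin MQ) (Fin MQ) ℝ) (hAQ : AQ.PosSemidef)
    (qa qb : Fin MQ → Fin d → ℝ)
    (ηq1 ηq2 : Fin d → ℝ) (hηq1 : ∀ l, 0 < ηq1 l) (hηq2 : ∀ l, 0 < ηq2 l)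
    (hQ : ∀ u x, Qhat u x = ∑ i, ∑ j, AQ i j *
      (gk ηq1 u (qa i) * gk ηq2 x (qb i)) * (gk ηq1 u (qa j) * gk ηq2 x (qb j)))
    -- Ĝ is a Gaussian PSD model of order M_G on ℝ^d × ℝ^{d'}
    (Ghat : (Fin d → ℝ) → (Fin d' → ℝ) → ℝ)
    (AG : Matrix (Fin MG) (Fin MG) ℝ) (hAG : AG.PosSemidef)
    (ga : Fin MG → Fin d → ℝ) (gb : Fin MG → Fin d' → ℝ)
    (ηg1 : Fin d → ℝ) (ηg2 : Fin d' → ℝ)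
    (hηg1 : ∀ l, 0 < ηg1 l) (hηg2 : ∀ l, 0 < ηg2 l)
    (hG : ∀ x y, Ghat x y = ∑ i, ∑ j, AG i j *
      (gk ηg1 x (ga i) * gk ηg2 y (gb i)) * (gk ηg1 x (ga j) * gk ηg2 y (gb j)))
    -- observations and the filtering recursion
    (z : ℕ → Fin d' → ℝ) (Z : ℕ → ℝ)
    (hZdef : ∀ n : ℕ, Z (n + 1) =
      ∫ x in E, Ghat x (z (n + 1)) * ∫ u in E, Qhat u x * πhat n u)
    (hZpos : ∀ n : ℕ, 0 < Z (n + 1))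
    (hrec : ∀ n : ℕ, ∀ x, πhat (n + 1) x =
      Ghat x (z (n + 1)) * (∫ u in E, Qhat u x * πhat n u) / Z (n + 1)) :
    ∀ n : ℕ, 1 ≤ n → IsGaussianPSD (MQ * MG) (πhat n) := by
  have hEK : E ⊆ Set.univ.pi fun _ : Fin d => Set.Icc (-1 : ℝ) 1 :=
    hE ▸ Set.pi_mono fun _ _ => Set.Ioo_subset_Icc_self
  have hK : IsCompact (Set.univ.pi fun _ : Fin d => Set.Icc (-1 : ℝ) 1) :=
    isCompact_univ_pi fun _ => isCompact_Icc
  have step : ∀ (N n : ℕ), IsGaussianPSD N (πhat n) →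
      IsGaussianPSD (MQ * MG) (πhat (n + 1)) := by
    intro N n h
    have hI := isGaussianPSD_setIntegral hAQ qa qb ηq1 hηq2 hK hEK h.continuous h.nonneg
    have hS := isGaussianPSD_section hAG ga gb hηg1 ηg2 (z (n + 1))
    convert (hI.mul hS).const_mul (inv_nonneg.2 (hZpos n).le) using 2 with x
    rw [hrec]
    simp only [hQ, hG]
    ring
  have key : ∀ n : ℕ, IsGaussianPSD (MQ * MG) (πhat (n + 1)) := by
    intro n
    induction n with
    | zero => exact step M0 0 hπ0
    | succ n ih => exact step _ _ ih
  intro n hn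
  obtain ⟨m, rfl⟩ := Nat.exists_eq_add_of_le' hn
  exact key m
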